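/- For all f, g ∈ L the following are equivalent: (i) f(P) ≤ g(P) for every (2,2)-box state P ∈ S; (ii) f(P) ≤ g(P) for every classically correlated state P (every convex combination of the 16 deterministic states ρ_{mnlk}); (iii) f(ρ_{mnlk}) ≤ g(ρ_{mnlk}) for all m,n,l,k ∈ {0,1}. In other words, restricting the set of states to the classically correlated states yields exactly the same partial order on the propositional system L. -/

import Mathlib

namespace BoxWorld

/-- A (2,2)-box assignment: `P a b α β` stands for `P(αβ|ab)`, where the measurement
settings are `a, b ∈ Fin 2` (with `x = 0`, `y = 1`) and the outcomes are `α, β ∈ Fin 2`. -/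
abbrev Box : Type := Fin 2 → Fin 2 → Fin 2 → Fin 2 → ℝ

/-- (P1) positivity, (P2) normalization, (P3) non-signalling. -/
def IsState (P : Box) : Prop :=
  (∀ a b α β, 0 ≤ P a b α β) ∧
  (∀ a b, ∑ α : Fin 2, ∑ β : Fin 2, P a b α β = 1) ∧
  (∀ a b b' α, ∑ β : Fin 2, P a b α β = ∑ β : Fin 2, P a b' α β) ∧
  (∀ a a' b β, ∑ α : Fin 2, P a b α β = ∑ α : Fin 2, P a' b α β)

/-- The set `S` of (2,2)-box states, as a subtype. -/
abbrev State : Type := {P : Box // IsState P}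

/-- The elementary question `e[ab, αβ]`, as a functional on states. -/
def elem (a b α β : Fin 2) : State → ℝ := fun P => P.1 a b α β

abbrev Idx : Type := Fin 2 × Fin 2 × Fin 2 × Fin 2

def elemI (i : Idx) : State → ℝ := elem i.1 i.2.1 i.2.2.1 i.2.2.2

/-- The logic `L` of the (2,2)-box world: all functionals `f = Σ_{e ∈ A} e`, where `A` is a
set of elementary questions whose pointwise sum is `≤ 1` at every state, together with the
complements `1 - f` of all such functionals. -/
def InLogic (f : State → ℝ) : Prop :=
  (∃ A : Finset Idx, (∀ P : State, ∑ i ∈ A, elemI i P ≤ 1) ∧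
      f = fun P => ∑ i ∈ A, elemI i P) ∨
  (∃ A : Finset Idx, (∀ P : State, ∑ i ∈ A, elemI i P ≤ 1) ∧
      f = fun P => 1 - ∑ i ∈ A, elemI i P)

/-- The deterministic state `ρ_{mnlk}`:
`ρ_{mnlk}(αβ|ab) = 1` iff `α ≡ m·a + n (mod 2)` and `β ≡ l·b + k (mod 2)`. -/
def detState (m n l k : Fin 2) : Box := fun a b α β =>
  if α = m * a + n ∧ β = l * b + k then 1 else 0

lemma sum_snd (c d α : Fin 2) :
    ∑ β : Fin 2, (if α = c ∧ β = d then (1:ℝ) else 0) = if α = c then 1 else 0 := by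
  fin_cases d <;> fin_cases c <;> fin_cases α <;> simp [Fin.sum_univ_two]

lemma sum_fst (c d β : Fin 2) :
    ∑ α : Fin 2, (if α = c ∧ β = d then (1:ℝ) else 0) = if β = d then 1 else 0 := by
  fin_cases d <;> fin_cases c <;> fin_cases β <;> simp [Fin.sum_univ_two]

lemma sum_ind (c : Fin 2) : ∑ α : Fin 2, (if α = c then (1:ℝ) else 0) = 1 := by
  fin_cases c <;> simp [Fin.sum_univ_two]

lemma detState_isState (m n l k : Fin 2) : IsState (detState m n l k) := by
  refine ⟨fun a b α β => ?_, fun a b => ?_, fun a b b' α => ?_, fun a a' b β => ?_⟩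
  · unfold detState; split <;> norm_num
  · simp only [detState, sum_snd, sum_ind]
  · simp only [detState, sum_snd]
  · simp only [detState, sum_fst]

/-- `ρ_{mnlk}` as an element of the state space `S`. -/
def detSt (m n l k : Fin 2) : State := ⟨detState m n l k, detState_isState m n l k⟩


/-- Two elementary questions are exclusive if one party, using the same setting in both,
gets different outcomes. -/
def Exclusive (i j : Idx) : Prop :=
  (i.1 = j.1 ∧ i.2.2.1 ≠ j.2.2.1) ∨ (i.2.1 = j.2.1 ∧ i.2.2.2 ≠ j.2.2.2)

lemma elemI_nonneg (i : Idx) (P : State) : 0 ≤ elemI i P := P.2.1 _ _ _ _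

lemma elemI_detSt (i : Idx) (m n l k : Fin 2) :
    elemI i (detSt m n l k) =
      if i.2.2.1 = m * i.1 + n ∧ i.2.2.2 = l * i.2.1 + k then 1 else 0 := rfl

lemma exists_affine_of_consistent : ∀ a a' α α' : Fin 2, ¬ (a = a' ∧ α ≠ α') →
    ∃ m n : Fin 2, α = m * a + n ∧ α' = m * a' + n := by
  decide

/-- Two elementary questions that are not exclusive are both certain in some deterministic
state. -/
lemma exists_detSt_of_not_exclusive {i j : Idx} (h : ¬ Exclusive i j) :
    ∃ m n l k, elemI i (detSt m n l k) = 1 ∧ elemI j (detSt m n l k) = 1 := by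
  obtain ⟨hα, hβ⟩ := not_or.mp h
  obtain ⟨m, n, h₁, h₂⟩ := exists_affine_of_consistent _ _ _ _ hα
  obtain ⟨l, k, h₃, h₄⟩ := exists_affine_of_consistent _ _ _ _ hβ
  exact ⟨m, n, l, k, by rw [elemI_detSt, if_pos ⟨h₁, h₃⟩], by rw [elemI_detSt, if_pos ⟨h₂, h₄⟩]⟩

lemma not_exclusive_self (i : Idx) : ¬ Exclusive i i := by simp [Exclusive]

lemma exclusive_of_add_le_one {i j : Idx}
    (h : ∀ m n l k, elemI i (detSt m n l k) + elemI j (detSt m n l k) ≤ 1) :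
    Exclusive i j := by
  by_contra hij
  obtain ⟨m, n, l, k, hi, hj⟩ := exists_detSt_of_not_exclusive hij
  have := h m n l k
  rw [hi, hj] at this
  norm_num at this

lemma pairwise_exclusive_of_sum_le_one {A : Finset Idx}
    (h : ∀ m n l k, ∑ i ∈ A, elemI i (detSt m n l k) ≤ 1) :
    (A : Set Idx).Pairwise Exclusive := by
  intro i hi j hj hij
  refine exclusive_of_add_le_one fun m n l k => le_trans ?_ (h m n l k)
  rw [← Finset.sum_pair (f := fun i => elemI i (detSt m n l k)) hij]
  exact Finset.sum_le_sum_of_subset_of_nonneg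
    (Finset.insert_subset hi (Finset.singleton_subset_iff.mpr hj))
    fun _ _ _ => elemI_nonneg _ _

/-- The measurement in which the first party measures `a` and the second party then measures
`c α`, depending on the first outcome `α`. -/
def firstTree (a : Fin 2) (c : Fin 2 → Fin 2) : Finset Idx :=
  Finset.univ.image fun p : Fin 2 × Fin 2 => (a, c p.1, p.1, p.2)

/-- The measurement in which the second party measures `b` and the first party then measures
`c β`, depending on the second outcome `β`. -/
def secondTree (b : Fin 2) (c : Fin 2 → Fin 2) : Finset Idx :=
  Finset.univ.image fun p : Fin 2 × Fin 2 => (c p.2, b, p.1, p.2)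

lemma sum_firstTree (a : Fin 2) (c : Fin 2 → Fin 2) (P : State) :
    ∑ i ∈ firstTree a c, elemI i P = 1 := by
  obtain ⟨-, hnorm, hsig, -⟩ := P.2
  rw [firstTree, Finset.sum_image (fun _ _ _ _ h => congrArg (fun i : Idx => i.2.2) h),
    Fintype.sum_prod_type, ← hnorm a 0]
  exact Finset.sum_congr rfl fun α _ => hsig a (c α) 0 α

lemma sum_secondTree (b : Fin 2) (c : Fin 2 → Fin 2) (P : State) :
    ∑ i ∈ secondTree b c, elemI i P = 1 := by
  obtain ⟨-, hnorm, -, hsig⟩ := P.2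
  rw [secondTree, Finset.sum_image (fun _ _ _ _ h => congrArg (fun i : Idx => i.2.2) h),
    Fintype.sum_prod_type_right, ← hnorm 0 b,
    Finset.sum_comm (f := fun α β => P.1 0 b α β)]
  exact Finset.sum_congr rfl fun β _ => hsig (c β) 0 b β

lemma common_setting {A : Finset Idx} (hA : (A : Set Idx).Pairwise Exclusive) :
    (∃ a, ∀ i ∈ A, i.1 = a) ∨ ∃ b, ∀ i ∈ A, i.2.1 = b := by
  have share : ∀ i ∈ A, ∀ j ∈ A, i.1 = j.1 ∨ i.2.1 = j.2.1 := by
    intro i hi j hj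
    rcases eq_or_ne i j with rfl | hij
    · exact .inl rfl
    · exact (hA hi hj hij).imp And.left And.left
  by_contra! h
  obtain ⟨i, hi, -⟩ := h.1 0
  obtain ⟨j, hj, hij⟩ := h.1 i.1
  obtain ⟨k, hk, hik⟩ := h.2 i.2.1
  have := share i hi j hj
  have := share i hi k hk
  have := share j hj k hk
  grind

/-- Every pairwise exclusive set of elementary questions extends to a complete one. -/
lemma exists_complete_superset {A : Finset Idx} (hA : (A : Set Idx).Pairwise Exclusive) :
    ∃ T, A ⊆ T ∧ ∀ P : State, ∑ i ∈ T, elemI i P = 1 := by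
  rcases common_setting hA with ⟨a, ha⟩ | ⟨b, hb⟩
  · have : ∀ α, ∃ b, ∀ i ∈ A, i.2.2.1 = α → i.2.1 = b := by
      intro α
      by_contra! h
      obtain ⟨i, hi, hiα, -⟩ := h 0
      obtain ⟨j, hj, hjα, hij⟩ := h i.2.1
      rcases hA hj hi (by rintro rfl; exact hij rfl) with h | h
      · exact h.2 (hjα.trans hiα.symm)
      · exact hij h.1
    choose c hc using this
    refine ⟨firstTree a c, fun i hi => ?_, sum_firstTree a c⟩
    exact Finset.mem_image.mpr ⟨i.2.2, Finset.mem_univ _,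
      Prod.ext (ha i hi).symm (Prod.ext (hc _ i hi rfl).symm rfl)⟩
  · have : ∀ β, ∃ a, ∀ i ∈ A, i.2.2.2 = β → i.1 = a := by
      intro β
      by_contra! h
      obtain ⟨i, hi, hiβ, -⟩ := h 0
      obtain ⟨j, hj, hjβ, hij⟩ := h i.1
      rcases hA hj hi (by rintro rfl; exact hij rfl) with h | h
      · exact hij h.1
      · exact h.2 (hjβ.trans hiβ.symm)
    choose c hc using this
    refine ⟨secondTree b c, fun i hi => ?_, sum_secondTree b c⟩
    exact Finset.mem_image.mpr ⟨i.2.2, Finset.mem_univ _,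
      Prod.ext (hc _ i hi rfl).symm (Prod.ext (hb i hi).symm rfl)⟩

/-- The complement of a sum of exclusive elementary questions is again such a sum. -/
lemma exists_sum_eq_one_sub {A : Finset Idx} (hA : ∀ P : State, ∑ i ∈ A, elemI i P ≤ 1) :
    ∃ B : Finset Idx, (∀ P : State, ∑ i ∈ B, elemI i P ≤ 1) ∧
      ∀ P : State, ∑ i ∈ B, elemI i P = 1 - ∑ i ∈ A, elemI i P := by
  obtain ⟨T, hAT, hT⟩ := exists_complete_superset
    (pairwise_exclusive_of_sum_le_one fun m n l k => hA (detSt m n l k))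
  have key : ∀ P : State, ∑ i ∈ T \ A, elemI i P = 1 - ∑ i ∈ A, elemI i P := fun P => by
    rw [← hT P, ← Finset.sum_sdiff hAT, add_sub_cancel_right]
  refine ⟨T \ A, fun P => ?_, key⟩
  rw [key, sub_le_self_iff]
  exact Finset.sum_nonneg fun i _ => elemI_nonneg i P

lemma InLogic.exists_eq_sum {f : State → ℝ} (hf : InLogic f) :
    ∃ A : Finset Idx, (∀ P : State, ∑ i ∈ A, elemI i P ≤ 1) ∧
      ∀ P, f P = ∑ i ∈ A, elemI i P := by
  obtain ⟨A, hA, rfl⟩ | ⟨A, hA, rfl⟩ := hf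
  · exact ⟨A, hA, fun _ => rfl⟩
  · obtain ⟨B, hB, h⟩ := exists_sum_eq_one_sub hA
    exact ⟨B, hB, fun P => (h P).symm⟩

lemma sum_add_sum_le_one {A B : Finset Idx}
    (h : ∀ m n l k, ∑ i ∈ A, elemI i (detSt m n l k) + ∑ i ∈ B, elemI i (detSt m n l k) ≤ 1)
    (P : State) : ∑ i ∈ A, elemI i P + ∑ i ∈ B, elemI i P ≤ 1 := by
  have hAB : Disjoint A B := by
    refine Finset.disjoint_left.mpr fun i hiA hiB => not_exclusive_self i ?_
    refine exclusive_of_add_le_one fun m n l k => le_trans (add_le_add ?_ ?_) (h m n l k)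
    · exact Finset.single_le_sum (f := fun i => elemI i (detSt m n l k))
        (fun _ _ => elemI_nonneg _ _) hiA
    · exact Finset.single_le_sum (f := fun i => elemI i (detSt m n l k))
        (fun _ _ => elemI_nonneg _ _) hiB
  simp only [← Finset.sum_union hAB] at h ⊢
  obtain ⟨T, hT, hsum⟩ := exists_complete_superset (pairwise_exclusive_of_sum_le_one h)
  rw [← hsum P]
  exact Finset.sum_le_sum_of_subset_of_nonneg hT fun _ _ _ => elemI_nonneg _ _

lemma le_of_le_on_detSt {f g : State → ℝ} (hf : InLogic f) (hg : InLogic g)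
    (h : ∀ m n l k, f (detSt m n l k) ≤ g (detSt m n l k)) (P : State) : f P ≤ g P := by
  obtain ⟨A, -, hfA⟩ := hf.exists_eq_sum
  obtain ⟨B, hB, hgB⟩ := hg.exists_eq_sum
  obtain ⟨C, -, hC⟩ := exists_sum_eq_one_sub hB
  have hg' : ∀ P, g P = 1 - ∑ i ∈ C, elemI i P := fun P => by rw [hC, hgB, sub_sub_cancel]
  simp only [hfA, hg', le_sub_iff_add_le] at h ⊢
  exact sum_add_sum_le_one h P

/-- for `f, g ∈ L`, the following are equivalent: (i) `f ≤ g` on all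
(2,2)-box states; (ii) `f ≤ g` on all classically correlated states (convex combinations
of the 16 deterministic states); (iii) `f ≤ g` on the 16 deterministic states. Hence
restricting to classically correlated states yields the same partial order on `L`. -/
theorem order_determined_by_classical_states (f g : State → ℝ)
    (hf : InLogic f) (hg : InLogic g) :
    ((∀ P : State, f P ≤ g P) ↔
      (∀ P : State,
        P.1 ∈ convexHull ℝ {B : Box | ∃ m n l k : Fin 2, B = detState m n l k} →
        f P ≤ g P)) ∧
    ((∀ P : State, f P ≤ g P) ↔
      (∀ m n l k : Fin 2, f (detSt m n l k) ≤ g (detSt m n l k))) := by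
  refine ⟨⟨fun h P _ => h P, fun h => le_of_le_on_detSt hf hg fun m n l k => ?_⟩,
    fun h m n l k => h _, le_of_le_on_detSt hf hg⟩
  exact h _ (subset_convexHull ℝ _ ⟨m, n, l, k, rfl⟩)

end BoxWorld
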